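/- In the p-parking model on Z/nZ with m cars, set K := n − m ≥ 1. Then for every X ⊆ Z/nZ with |X| = K, writing ℓ_i = Δ_i X for i ∈ Z/KZ (so Σ_i ℓ_i = m), one has P(TL = X) = n^{−m} · multinom(m; ℓ_0, …, ℓ_{K−1}) · Π_{i∈Z/KZ} (ℓ_i + 1)^{ℓ_i − 1}, where multinom(m; ℓ_0,…,ℓ_{K−1}) = m!/(ℓ_0!⋯ℓ_{K−1}!) and (ℓ+1)^{ℓ−1} is interpreted as 1 when ℓ = 0. In particular, this probability does not depend on p ∈ (0,1). -/

import Mathlib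

open Finset MeasureTheory Filter Asymptotics
open scoped Classical

namespace Golf

/-- Canonical position of a vertex of the cycle `Z/nZ` in `{1, …, n}`. -/
def cpos {n : ℕ} (v : Fin n) : ℕ := if v.val = 0 then n else v.val

/-- Shift a vertex by `d` steps in the positive direction. -/
def shiftR {n : ℕ} (v : Fin n) (d : ℕ) : Fin n :=
  ⟨(v.val + d) % n, Nat.mod_lt _ (Nat.lt_of_le_of_lt (Nat.zero_le _) v.isLt)⟩

/-- Shift a vertex by `d` steps in the negative direction. -/
def shiftL {n : ℕ} (v : Fin n) (d : ℕ) : Fin n := shiftR v (n - d % n)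

/-- Distance (in `[1, n]`) from `v` to the nearest element of `H` in the positive direction. -/
def distR {n : ℕ} (H : Finset (Fin n)) (v : Fin n) : ℕ :=
  if h : ((Finset.Icc 1 n).filter fun d => shiftR v d ∈ H).Nonempty then
    ((Finset.Icc 1 n).filter fun d => shiftR v d ∈ H).min' h
  else 0

/-- Distance (in `[1, n]`) from `v` to the nearest element of `H` in the negative direction. -/
def distL {n : ℕ} (H : Finset (Fin n)) (v : Fin n) : ℕ :=
  if h : ((Finset.Icc 1 n).filter fun d => shiftL v d ∈ H).Nonempty then
    ((Finset.Icc 1 n).filter fun d => shiftL v d ∈ H).min' h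
  else 0

/-- Probability that the ball activated at `v` fills the nearest free hole in the positive
direction, when the current set of free holes is `H`, for the `p`-biased random walk. -/
noncomputable def rightProb {n : ℕ} (p : ℝ) (H : Finset (Fin n)) (v : Fin n) : ℝ :=
  if p = 1 / 2 then (distL H v : ℝ) / ((distL H v : ℝ) + (distR H v : ℝ))
  else (1 - ((1 - p) / p) ^ distL H v) / (1 - ((1 - p) / p) ^ (distL H v + distR H v))

/-- New set of free holes after the ball at `v` makes its choice
(`true` = fill the nearest free hole in the positive direction). -/
def golfStep {n : ℕ} (H : Finset (Fin n)) (v : Fin n) (choice : Bool) : Finset (Fin n) :=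
  if choice then H.erase (shiftR v (distR H v)) else H.erase (shiftL v (distL H v))

/-- Final set of free holes after activating the listed balls with the listed choices. -/
def golfRun {n : ℕ} : List (Fin n) → List Bool → Finset (Fin n) → Finset (Fin n)
  | v :: vs, c :: cs, H => golfRun vs cs (golfStep H v c)
  | _, _, H => H

/-- Probability of a given sequence of left/right choices. -/
noncomputable def golfWeight {n : ℕ} (p : ℝ) :
    List (Fin n) → List Bool → Finset (Fin n) → ℝ
  | v :: vs, c :: cs, H =>
      (if c then rightProb p H v else 1 - rightProb p H v) * golfWeight p vs cs (golfStep H v c)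
  | _, _, _ => 1

/-- Initial data of the golf model: an initial configuration with `nb` balls (listed in their
activation order, encoded as an embedding `Fin nb ↪ Fin n`) and `nt` holes, the balls and holes
being on distinct vertices.  The initial configuration together with the activation order is
uniform on this set. -/
noncomputable def golfInit (n nb nt : ℕ) : Finset ((Fin nb ↪ Fin n) × Finset (Fin n)) :=
  Finset.univ.filter fun fT => fT.2.card = nt ∧ ∀ i, fT.1 i ∉ fT.2

/-- Expectation of `g B⁰ T⁰ TL` in the golf model on `Z/nZ` with `nb` balls, `nt` holes and
walk parameter `p`, where `B⁰` is the initial set of balls, `T⁰` the initial set of holes and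
`TL` the final set of free holes. -/
noncomputable def golfExp (n nb nt : ℕ) (p : ℝ)
    (g : Finset (Fin n) → Finset (Fin n) → Finset (Fin n) → ℝ) : ℝ :=
  (∑ fT ∈ golfInit n nb nt, ∑ cs : Fin nb → Bool,
      golfWeight p (List.ofFn ⇑fT.1) (List.ofFn cs) fT.2 *
        g (Finset.univ.map fT.1) fT.2 (golfRun (List.ofFn ⇑fT.1) (List.ofFn cs) fT.2)) /
    (golfInit n nb nt).card

/-- `golfProb n nb nt p X` is the probability that the final set of free holes is `X`. -/
noncomputable def golfProb (n nb nt : ℕ) (p : ℝ) (X : Finset (Fin n)) : ℝ :=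
  golfExp n nb nt p fun _ _ TL => if TL = X then 1 else 0

/-- Sorted list of the canonical positions of the elements of `X`. -/
def sortedPos {n : ℕ} (X : Finset (Fin n)) : List ℕ := (X.image cpos).sort (· ≤ ·)

/-- `blockSize X i` is the size `Δ_i X` of the `i`-th block of `X`. -/
def blockSize {n : ℕ} (X : Finset (Fin n)) (i : ℕ) : ℕ :=
  let q := sortedPos X
  let k := q.length
  (q.getD (i % k) 0 + n - q.getD ((i + k - 1) % k) 0 - 1) % n

/-- `blockSet X i` is the `i`-th block `B_i` of `X`: the set of vertices strictly between
`x_i` and `x_{i+1}` in the positive direction. -/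
def blockSet {n : ℕ} (X : Finset (Fin n)) (i : ℕ) : Finset (Fin n) :=
  let q := sortedPos X
  let k := q.length
  let lo := q.getD ((i + k - 1) % k) 0
  let hi := q.getD (i % k) 0
  Finset.univ.filter fun v =>
    if lo < hi then lo < cpos v ∧ cpos v < hi else cpos v < hi ∨ lo < cpos v

/-- Size of the largest block of `X`. -/
def maxBlockSize {n : ℕ} (X : Finset (Fin n)) : ℕ :=
  (Finset.range X.card).sup (blockSize X)

/-- `multinom3 a b c` is the multinomial coefficient `(a+b+c)! / (a! b! c!)`. -/
def multinom3 (a b c : ℕ) : ℕ :=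
  (a + b + c).factorial / (a.factorial * b.factorial * c.factorial)

end Golf

namespace Golf

/-- One parking step: the car starting at `v` parks there if `v` is free, and otherwise
follows its left/right choice towards the nearest free spot. -/
def parkStep {n : ℕ} (H : Finset (Fin n)) (v : Fin n) (choice : Bool) : Finset (Fin n) :=
  if v ∈ H then H.erase v else golfStep H v choice

/-- Final set of free spots after the listed cars have parked. -/
def parkRun {n : ℕ} : List (Fin n) → List Bool → Finset (Fin n) → Finset (Fin n)
  | v :: vs, c :: cs, H => parkRun vs cs (parkStep H v c)
  | _, _, H => H

/-- Probability of a given sequence of left/right choices in the parking process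
(a fair, unused coin is flipped for a car whose starting spot is free). -/
noncomputable def parkWeight {n : ℕ} (p : ℝ) :
    List (Fin n) → List Bool → Finset (Fin n) → ℝ
  | v :: vs, c :: cs, H =>
      (if v ∈ H then 1 / 2 else if c then rightProb p H v else 1 - rightProb p H v) *
        parkWeight p vs cs (parkStep H v c)
  | _, _, _ => 1

/-- Expectation of `g vs TL` in the `p`-parking model on `Z/nZ` with `m` cars, where
`vs` is the sequence of starting vertices of the cars (i.i.d. uniform) and `TL` is the final
set of free spots. -/
noncomputable def parkExp (n m : ℕ) (p : ℝ)
    (g : (Fin m → Fin n) → Finset (Fin n) → ℝ) : ℝ :=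
  (∑ vs : Fin m → Fin n, ∑ cs : Fin m → Bool,
      parkWeight p (List.ofFn vs) (List.ofFn cs) Finset.univ *
        g vs (parkRun (List.ofFn vs) (List.ofFn cs) Finset.univ)) /
    (n : ℝ) ^ m

/-- `parkProb n m p X` is the probability that the final set of free spots is `X`. -/
noncomputable def parkProb (n m : ℕ) (p : ℝ) (X : Finset (Fin n)) : ℝ :=
  parkExp n m p fun _ TL => if TL = X then 1 else 0

end Golf

namespace Golf

/-! ### Normalised Abel polynomials -/

/-- The Abel polynomial `x (x + n)^(n-1)` divided by `n!`. -/
noncomputable def abelPoly : ℕ → ℝ → ℝ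
  | 0, _ => 1
  | n + 1, x => x * (x + n + 1) ^ n / (n + 1).factorial

theorem abelPoly_succ_zero (n : ℕ) : abelPoly (n + 1) 0 = 0 := by
  simp [abelPoly]

theorem hasDerivAt_abelPoly (n : ℕ) (x : ℝ) :
    HasDerivAt (abelPoly (n + 1)) (abelPoly n (x + 1)) x := by
  have h := ((hasDerivAt_id x).mul
    ((((hasDerivAt_id x).add_const (n : ℝ)).add_const (1 : ℝ)).pow n)).div_const
      ((n + 1).factorial : ℝ)
  have hf : abelPoly (n + 1) =
      fun y : ℝ => (id * (fun y : ℝ => id y + n + 1) ^ n : ℝ → ℝ) y / ((n + 1).factorial : ℝ) := by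
    funext y
    simp [abelPoly]
  rw [hf]
  refine h.congr_deriv ?_
  have hfac : ((n + 1).factorial : ℝ) ≠ 0 := by positivity
  cases n with
  | zero => simp [abelPoly]
  | succ k =>
    have hk : ((k + 1).factorial : ℝ) ≠ 0 := by positivity
    simp only [abelPoly, Nat.factorial_succ (k + 1)]
    push_cast
    simp
    field_simp
    ring

/-- The normalised Abel polynomials form a sequence of convolution type. -/
theorem sum_abelPoly_mul (n : ℕ) (x y : ℝ) :
    ∑ ij ∈ antidiagonal n, abelPoly ij.1 x * abelPoly ij.2 y = abelPoly n (x + y) := by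
  induction n generalizing y with
  | zero => simp [abelPoly]
  | succ n ih =>
    set D : ℝ → ℝ := fun y =>
      ∑ ij ∈ antidiagonal n, abelPoly ij.1 x * abelPoly (ij.2 + 1) y - abelPoly (n + 1) (x + y)
      with hD
    have hderiv : ∀ z, HasDerivAt D 0 z := by
      intro z
      have h1 : HasDerivAt
          (fun y => ∑ ij ∈ antidiagonal n, abelPoly ij.1 x * abelPoly (ij.2 + 1) y)
          (∑ ij ∈ antidiagonal n, abelPoly ij.1 x * abelPoly ij.2 (z + 1)) z :=
        HasDerivAt.fun_sum fun ij _ => (hasDerivAt_abelPoly ij.2 z).const_mul _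
      have h2 : HasDerivAt (fun y => abelPoly (n + 1) (x + y)) (abelPoly n (x + z + 1)) z :=
        (hasDerivAt_abelPoly n (x + z)).comp_const_add x z
      refine (h1.sub h2).congr_deriv ?_
      rw [ih, add_assoc, sub_self]
    have hconst := is_const_of_deriv_eq_zero (fun z => (hderiv z).differentiableAt)
      (fun z => (hderiv z).deriv) y 0
    simp only [hD, abelPoly_succ_zero, mul_zero, sum_const_zero, add_zero] at hconst
    rw [Finset.Nat.sum_antidiagonal_succ']
    simp only [abelPoly, mul_one] at hconst ⊢
    linarith

/-- The normalised parking number `(l + 1)^(l - 1) / l!`. -/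
noncomputable def parkingNumber (l : ℕ) : ℝ := ((l : ℝ) + 1) ^ (l - 1) / l.factorial

theorem parkingNumber_eq_abelPoly (l : ℕ) : parkingNumber l = abelPoly l 1 := by
  cases l with
  | zero => simp [parkingNumber, abelPoly]
  | succ k => simp [parkingNumber, abelPoly]; ring

theorem sum_parkingNumber_mul (n : ℕ) :
    ((n : ℝ) + 2) / 2 * ∑ ij ∈ antidiagonal n, parkingNumber ij.1 * parkingNumber ij.2 =
      (n + 1) * parkingNumber (n + 1) := by
  simp only [parkingNumber_eq_abelPoly, sum_abelPoly_mul]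
  cases n with
  | zero => norm_num [abelPoly]
  | succ k =>
    have hk : ((k + 1).factorial : ℝ) ≠ 0 := by positivity
    simp only [abelPoly, Nat.factorial_succ (k + 1)]
    push_cast
    field_simp
    ring

/-- The last-car recursion for one block: the sum over the last spot filled does not depend on
the rule `ρ` by which a car chooses its direction. -/
theorem sum_Ico_parkingNumber (ρ : ℕ → ℕ → ℝ) (D : ℕ) :
    ∑ k ∈ Ico 1 D, parkingNumber (k - 1) * parkingNumber (D - k - 1) *
        (1 + ∑ d ∈ Ico 1 k, ρ d (k - d) + ∑ d ∈ Ico 1 (D - k), (1 - ρ d (D - k - d))) =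
      ((D - 1 : ℕ) : ℝ) * parkingNumber (D - 1) := by
  rcases Nat.lt_or_ge D 2 with hD | hD
  · have : D - 1 = 0 := by omega
    rw [Finset.Ico_eq_empty (by omega), this]
    simp
  obtain ⟨n, rfl⟩ := Nat.exists_eq_add_of_le' hD
  set R : ℕ → ℝ := fun k => ∑ d ∈ Ico 1 k, ρ d (k - d) with hR
  set L : ℕ → ℝ := fun k => ∑ d ∈ Ico 1 k, (1 - ρ d (k - d)) with hL
  have hRL : ∀ k, R (k + 1) + L (k + 1) = k := by
    intro k
    simp only [hR, hL, ← Finset.sum_add_distrib, add_sub_cancel]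
    simp
  have h1 : ∑ k ∈ Ico 1 (n + 2), parkingNumber (k - 1) * parkingNumber (n + 2 - k - 1) *
      (1 + R k + L (n + 2 - k)) = ∑ ij ∈ antidiagonal n,
        parkingNumber ij.1 * parkingNumber ij.2 * (1 + R (ij.1 + 1) + L (ij.2 + 1)) := by
    rw [Finset.Nat.sum_antidiagonal_eq_sum_range_succ_mk, Finset.sum_Ico_eq_sum_range]
    refine Finset.sum_congr rfl fun k hk => ?_
    have hk' : k < n + 1 := by simpa using hk
    have e1 : 1 + k - 1 = k := by omega
    have e2 : n + 2 - (1 + k) = n - k + 1 := by omega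
    rw [e1, e2, Nat.add_sub_cancel, add_comm 1 k]
  have h2 : ∑ ij ∈ antidiagonal n,
        parkingNumber ij.1 * parkingNumber ij.2 * (1 + R (ij.1 + 1) + L (ij.2 + 1)) =
      ∑ ij ∈ antidiagonal n,
        parkingNumber ij.1 * parkingNumber ij.2 * (1 + R (ij.2 + 1) + L (ij.1 + 1)) := by
    rw [← Finset.Nat.sum_antidiagonal_swap]
    refine Finset.sum_congr rfl fun ij _ => ?_
    simp only [Prod.fst_swap, Prod.snd_swap]
    ring
  have h3 : ∑ ij ∈ antidiagonal n,
        parkingNumber ij.1 * parkingNumber ij.2 * (1 + R (ij.1 + 1) + L (ij.2 + 1)) +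
      ∑ ij ∈ antidiagonal n,
        parkingNumber ij.1 * parkingNumber ij.2 * (1 + R (ij.2 + 1) + L (ij.1 + 1)) =
      ((n : ℝ) + 2) * ∑ ij ∈ antidiagonal n, parkingNumber ij.1 * parkingNumber ij.2 := by
    rw [← Finset.sum_add_distrib, Finset.mul_sum]
    refine Finset.sum_congr rfl fun ij hij => ?_
    have hsum : (ij.1 : ℝ) + ij.2 = n := by
      exact_mod_cast HasAntidiagonal.mem_antidiagonal.mp hij
    linear_combination parkingNumber ij.1 * parkingNumber ij.2 *
      (hRL ij.1 + hRL ij.2 + hsum)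
  have h4 := sum_parkingNumber_mul n
  have e : n + 2 - 1 = n + 1 := by omega
  rw [h1, e]
  push_cast
  linarith

end Golf

namespace Golf

/-! ### Distances on the cycle -/

section Cycle

variable {n : ℕ}

theorem shiftR_shiftR (v : Fin n) (a b : ℕ) : shiftR (shiftR v a) b = shiftR v (a + b) := by
  simp [shiftR, add_assoc]

theorem shiftR_eq_iff_modEq (v : Fin n) (a b : ℕ) :
    shiftR v a = shiftR v b ↔ a ≡ b [MOD n] := by
  simp only [shiftR, Fin.mk.injEq]
  exact Nat.ModEq.add_iff_left (Nat.ModEq.refl _)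

theorem shiftR_zero (v : Fin n) : shiftR v 0 = v := by
  simp [shiftR, Nat.mod_eq_of_lt v.isLt]

theorem shiftR_self (v : Fin n) : shiftR v n = v := by
  simp [shiftR, Nat.mod_eq_of_lt v.isLt]

theorem eq_of_shiftR_eq {v : Fin n} {a b : ℕ} (ha : a < n) (hb : b < n)
    (h : shiftR v a = shiftR v b) : a = b :=
  Nat.ModEq.eq_of_lt_of_lt ((shiftR_eq_iff_modEq v a b).mp h) ha hb

theorem shiftL_shiftR (v : Fin n) {d e : ℕ} (h : e ≤ d) :
    shiftL (shiftR v d) e = shiftR v (d - e) := by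
  have hn : 0 < n := v.pos
  rw [shiftL, shiftR_shiftR, shiftR_eq_iff_modEq]
  have h1 : e % n < n := Nat.mod_lt _ hn
  have h2 := Nat.mod_add_div e n
  have h3 : d + (n - e % n) = d - e + n * (e / n + 1) := by
    rw [mul_add]; omega
  rw [h3]
  simp [Nat.ModEq]

theorem shiftR_shiftL (v : Fin n) {d e : ℕ} (hd : d ≤ n) (h : e ≤ d) :
    shiftR (shiftL v d) e = shiftL v (d - e) := by
  have hv : v = shiftR (shiftL v d) d := by
    obtain ⟨w, rfl⟩ : ∃ w, v = shiftR w d := by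
      refine ⟨shiftR v (n - d), ?_⟩
      rw [shiftR_shiftR, Nat.sub_add_cancel hd, shiftR_self]
    rw [shiftL_shiftR _ le_rfl, Nat.sub_self, shiftR_zero]
  conv_rhs => rw [hv]
  rw [shiftL_shiftR _ (Nat.sub_le _ _)]
  congr 1
  omega

theorem shiftR_shiftL_self (v : Fin n) {d : ℕ} (hd : d ≤ n) : shiftR (shiftL v d) d = v := by
  rw [shiftR_shiftL v hd le_rfl, Nat.sub_self, shiftL, Nat.zero_mod, Nat.sub_zero, shiftR_self]

theorem exists_shiftR_eq (v w : Fin n) : ∃ d, 1 ≤ d ∧ d ≤ n ∧ shiftR v d = w := by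
  have hv := v.isLt
  have hw := w.isLt
  rcases lt_or_ge v.val w.val with h | h
  · refine ⟨w - v, by omega, by omega, ?_⟩
    ext
    have : v.val + (w.val - v.val) = w.val := by omega
    simp [shiftR, this, Nat.mod_eq_of_lt hw]
  · refine ⟨w + n - v, by omega, by omega, ?_⟩
    ext
    have : v.val + (w.val + n - v.val) = w.val + n := by omega
    simp [shiftR, this, Nat.mod_eq_of_lt hw]

theorem exists_shiftL_eq (v w : Fin n) : ∃ d, 1 ≤ d ∧ d ≤ n ∧ shiftL v d = w := by
  obtain ⟨d, h1, h2, h3⟩ := exists_shiftR_eq w v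
  refine ⟨d, h1, h2, ?_⟩
  rw [← h3, shiftL_shiftR _ le_rfl, Nat.sub_self, shiftR_zero]

theorem distR_spec {H : Finset (Fin n)} (hH : H.Nonempty) (v : Fin n) :
    1 ≤ distR H v ∧ distR H v ≤ n ∧ shiftR v (distR H v) ∈ H ∧
      ∀ d, 1 ≤ d → d < distR H v → shiftR v d ∉ H := by
  have hne : ((Finset.Icc 1 n).filter fun d => shiftR v d ∈ H).Nonempty := by
    obtain ⟨w, hw⟩ := hH
    obtain ⟨d, h1, h2, rfl⟩ := exists_shiftR_eq v w
    exact ⟨d, by simp [h1, h2, hw]⟩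
  have hdist : distR H v = ((Finset.Icc 1 n).filter fun d => shiftR v d ∈ H).min' hne := by
    rw [distR, dif_pos hne]
  have hmem := Finset.min'_mem _ hne
  rw [← hdist, Finset.mem_filter, Finset.mem_Icc] at hmem
  refine ⟨hmem.1.1, hmem.1.2, hmem.2, fun d h1 h2 hd => ?_⟩
  have := Finset.min'_le ((Finset.Icc 1 n).filter fun d => shiftR v d ∈ H) d
    (by simp only [Finset.mem_filter, Finset.mem_Icc]; exact ⟨⟨h1, by omega⟩, hd⟩)
  omega

theorem distL_spec {H : Finset (Fin n)} (hH : H.Nonempty) (v : Fin n) :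
    1 ≤ distL H v ∧ distL H v ≤ n ∧ shiftL v (distL H v) ∈ H ∧
      ∀ d, 1 ≤ d → d < distL H v → shiftL v d ∉ H := by
  have hne : ((Finset.Icc 1 n).filter fun d => shiftL v d ∈ H).Nonempty := by
    obtain ⟨w, hw⟩ := hH
    obtain ⟨d, h1, h2, rfl⟩ := exists_shiftL_eq v w
    exact ⟨d, by simp [h1, h2, hw]⟩
  have hdist : distL H v = ((Finset.Icc 1 n).filter fun d => shiftL v d ∈ H).min' hne := by
    rw [distL, dif_pos hne]
  have hmem := Finset.min'_mem _ hne
  rw [← hdist, Finset.mem_filter, Finset.mem_Icc] at hmem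
  refine ⟨hmem.1.1, hmem.1.2, hmem.2, fun d h1 h2 hd => ?_⟩
  have := Finset.min'_le ((Finset.Icc 1 n).filter fun d => shiftL v d ∈ H) d
    (by simp only [Finset.mem_filter, Finset.mem_Icc]; exact ⟨⟨h1, by omega⟩, hd⟩)
  omega

theorem distR_eq {H : Finset (Fin n)} {v : Fin n} {d : ℕ} (h1 : 1 ≤ d) (hd : shiftR v d ∈ H)
    (hlt : ∀ e, 1 ≤ e → e < d → shiftR v e ∉ H) : distR H v = d := by
  obtain ⟨s1, _, s3, s4⟩ := distR_spec ⟨_, hd⟩ v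
  rcases lt_trichotomy (distR H v) d with h | h | h
  · exact absurd s3 (hlt _ s1 h)
  · exact h
  · exact absurd hd (s4 _ h1 h)

theorem distL_eq {H : Finset (Fin n)} {v : Fin n} {d : ℕ} (h1 : 1 ≤ d) (hd : shiftL v d ∈ H)
    (hlt : ∀ e, 1 ≤ e → e < d → shiftL v e ∉ H) : distL H v = d := by
  obtain ⟨s1, _, s3, s4⟩ := distL_spec ⟨_, hd⟩ v
  rcases lt_trichotomy (distL H v) d with h | h | h
  · exact absurd s3 (hlt _ s1 h)
  · exact h
  · exact absurd hd (s4 _ h1 h)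

section Gap

variable {H : Finset (Fin n)} {y : Fin n} {d : ℕ}

theorem distL_shiftR (hy : y ∈ H) (h1 : 1 ≤ d) (h2 : d < distR H y) :
    distL H (shiftR y d) = d := by
  have s := distR_spec ⟨y, hy⟩ y
  refine distL_eq h1 ?_ fun e he1 he2 => ?_
  · rwa [shiftL_shiftR _ le_rfl, Nat.sub_self, shiftR_zero]
  · rw [shiftL_shiftR _ he2.le]
    exact s.2.2.2 _ (by omega) (by omega)

theorem distR_shiftR (hy : y ∈ H) (h2 : d < distR H y) :
    distR H (shiftR y d) = distR H y - d := by
  have s := distR_spec ⟨y, hy⟩ y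
  refine distR_eq (by omega) ?_ fun e he1 he2 => ?_
  · rw [shiftR_shiftR, Nat.add_sub_cancel' h2.le]
    exact s.2.2.1
  · rw [shiftR_shiftR]
    exact s.2.2.2 _ (by omega) (by omega)

theorem shiftL_distL_shiftR (hy : y ∈ H) (h1 : 1 ≤ d) (h2 : d < distR H y) :
    shiftL (shiftR y d) (distL H (shiftR y d)) = y := by
  rw [distL_shiftR hy h1 h2, shiftL_shiftR _ le_rfl, Nat.sub_self, shiftR_zero]

theorem shiftR_distR_shiftR (hy : y ∈ H) (h2 : d < distR H y) :
    shiftR (shiftR y d) (distR H (shiftR y d)) = shiftR y (distR H y) := by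
  rw [distR_shiftR hy h2, shiftR_shiftR, Nat.add_sub_cancel' h2.le]

theorem distL_lt_distR_shiftL (hH : H.Nonempty) {v : Fin n} (hv : v ∉ H) :
    distL H v < distR H (shiftL v (distL H v)) := by
  obtain ⟨s1, s2, s3, s4⟩ := distL_spec hH v
  obtain ⟨r1, r2, r3, r4⟩ := distR_spec hH (shiftL v (distL H v))
  by_contra! hle
  rw [shiftR_shiftL v s2 hle] at r3
  rcases hle.eq_or_lt with h | h
  · rw [h, Nat.sub_self, shiftL, Nat.zero_mod, Nat.sub_zero, shiftR_self] at r3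
    exact hv r3
  · exact s4 _ (by omega) (by omega) r3

/-- Two points of `H` with the same successor coincide. -/
theorem eq_of_shiftR_distR_eq {x : Fin n} (hx : x ∈ H) (hy : y ∈ H)
    (h : shiftR x (distR H x) = shiftR y (distR H y)) : x = y := by
  wlog hle : distR H x ≤ distR H y generalizing x y
  · exact (this hy hx h.symm (by omega)).symm
  obtain ⟨s1, s2, s3, s4⟩ := distR_spec ⟨x, hx⟩ x
  obtain ⟨r1, r2, r3, r4⟩ := distR_spec ⟨x, hx⟩ y
  have h' := congrArg (fun z => shiftL z (distR H x)) h
  simp only [shiftL_shiftR _ le_rfl, shiftL_shiftR _ hle, Nat.sub_self, shiftR_zero] at h'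
  rcases hle.eq_or_lt with h0 | h0
  · rw [h', h0, Nat.sub_self, shiftR_zero]
  · rw [h'] at hx
    exact absurd hx (r4 _ (by omega) (by omega))

/-- A sum over the complement of `H` splits along the blocks of `H`. -/
theorem sum_compl_eq_sum_blocks {M : Type*} [AddCommMonoid M] (hH : H.Nonempty) (f : Fin n → M) :
    ∑ v ∈ Hᶜ, f v = ∑ y ∈ H, ∑ d ∈ Ico 1 (distR H y), f (shiftR y d) := by
  rw [Finset.sum_sigma']
  refine Finset.sum_bij' (fun v _ => ⟨shiftL v (distL H v), distL H v⟩)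
    (fun a _ => shiftR a.1 a.2) ?_ ?_ ?_ ?_ ?_
  · intro v hv
    rw [Finset.mem_compl] at hv
    obtain ⟨s1, s2, s3, s4⟩ := distL_spec hH v
    simp only [Finset.mem_sigma, Finset.mem_Ico]
    exact ⟨s3, s1, distL_lt_distR_shiftL hH hv⟩
  · rintro ⟨y, d⟩ ha
    simp only [Finset.mem_sigma, Finset.mem_Ico] at ha
    rw [Finset.mem_compl]
    exact (distR_spec hH y).2.2.2 d ha.2.1 ha.2.2
  · intro v _
    exact shiftR_shiftL_self v (distL_spec hH v).2.1
  · rintro ⟨y, d⟩ ha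
    simp only [Finset.mem_sigma, Finset.mem_Ico] at ha
    have h1 := shiftL_distL_shiftR ha.1 ha.2.1 ha.2.2
    have h2 := distL_shiftR ha.1 ha.2.1 ha.2.2
    simp only [h2] at h1 ⊢
    rw [h1]
  · intro v _
    rw [shiftR_shiftL_self v (distL_spec hH v).2.1]

theorem sum_distR_sub_one (hH : H.Nonempty) : ∑ y ∈ H, (distR H y - 1) = n - H.card := by
  have h := sum_compl_eq_sum_blocks hH (fun _ => (1 : ℕ))
  simp only [Finset.sum_const, smul_eq_mul, mul_one, Nat.card_Ico, Finset.card_compl,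
    Fintype.card_fin] at h
  exact h.symm

/-! Effect on the gaps of adding one point to `H`. -/

theorem distR_insert_left (hy : y ∈ H) (h1 : 1 ≤ d) (h2 : d < distR H y) :
    distR (insert (shiftR y d) H) y = d := by
  obtain ⟨s1, s2, s3, s4⟩ := distR_spec ⟨y, hy⟩ y
  refine distR_eq h1 (Finset.mem_insert_self _ _) fun e he1 he2 hmem => ?_
  rcases Finset.mem_insert.mp hmem with h | h
  · have := eq_of_shiftR_eq (by omega) (by omega) h
    omega
  · exact s4 _ he1 (by omega) h

theorem distR_insert_right (hy : y ∈ H) (h2 : d < distR H y) :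
    distR (insert (shiftR y d) H) (shiftR y d) = distR H y - d := by
  obtain ⟨s1, s2, s3, s4⟩ := distR_spec ⟨y, hy⟩ y
  refine distR_eq (by omega) ?_ fun e he1 he2 hmem => ?_
  · rw [shiftR_shiftR, Nat.add_sub_cancel' h2.le]
    exact Finset.mem_insert_of_mem s3
  · rw [shiftR_shiftR] at hmem
    rcases Finset.mem_insert.mp hmem with h | h
    · have := eq_of_shiftR_eq (by omega) (by omega) h
      omega
    · exact s4 _ (by omega) (by omega) h

theorem distR_insert_of_ne {x : Fin n} (hy : y ∈ H) (hx : x ∈ H) (hxy : x ≠ y) (h1 : 1 ≤ d)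
    (h2 : d < distR H y) : distR (insert (shiftR y d) H) x = distR H x := by
  obtain ⟨s1, s2, s3, s4⟩ := distR_spec ⟨x, hx⟩ x
  refine distR_eq s1 (Finset.mem_insert_of_mem s3) fun e he1 he2 hmem => ?_
  rcases Finset.mem_insert.mp hmem with h | h
  · have ha := shiftL_distL_shiftR hy h1 h2
    rw [← h, shiftL_distL_shiftR hx he1 he2] at ha
    exact hxy ha
  · exact s4 _ he1 he2 h

end Gap

end Cycle

end Golf

namespace Golf

/-! ### The parking process as a Markov chain on the sets of free spots -/

section Chain

variable {n : ℕ}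

/-- The weight of the choice `c` for a car starting at `v` when the free spots are `H`. -/
noncomputable def stepWeight (p : ℝ) (H : Finset (Fin n)) (v : Fin n) (c : Bool) : ℝ :=
  if v ∈ H then 1 / 2 else if c then rightProb p H v else 1 - rightProb p H v

/-- The transition matrix of the set of free spots, multiplied by `n`. -/
noncomputable def stepMatrix (n : ℕ) (p : ℝ) : Matrix (Finset (Fin n)) (Finset (Fin n)) ℝ :=
  Matrix.of fun H H' =>
    ∑ v : Fin n, ∑ c : Bool, stepWeight p H v c * if parkStep H v c = H' then 1 else 0

theorem sum_parkWeight_eq_pow (p : ℝ) (m : ℕ) (H X : Finset (Fin n)) :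
    ∑ vs : Fin m → Fin n, ∑ cs : Fin m → Bool,
      parkWeight p (List.ofFn vs) (List.ofFn cs) H *
        (if parkRun (List.ofFn vs) (List.ofFn cs) H = X then 1 else 0) =
      (stepMatrix n p ^ m) H X := by
  induction m generalizing H with
  | zero => simp [parkWeight, parkRun, Matrix.one_apply]
  | succ m ih =>
    have h1 : (stepMatrix n p ^ (m + 1)) H X =
        ∑ v : Fin n, ∑ c : Bool, stepWeight p H v c * (stepMatrix n p ^ m) (parkStep H v c) X := by
      rw [pow_succ', Matrix.mul_apply]
      simp only [stepMatrix, Matrix.of_apply, Finset.sum_mul]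
      rw [Finset.sum_comm]
      refine Finset.sum_congr rfl fun v _ => ?_
      rw [Finset.sum_comm]
      refine Finset.sum_congr rfl fun c _ => ?_
      simp
    rw [h1, ← (Fin.consEquiv fun _ => Fin n).sum_comp, Fintype.sum_prod_type]
    refine Finset.sum_congr rfl fun v _ => ?_
    simp_rw [← (Fin.consEquiv fun _ => Bool).sum_comp, Fintype.sum_prod_type]
    rw [Finset.sum_comm]
    refine Finset.sum_congr rfl fun c _ => ?_
    rw [← ih, Finset.mul_sum]
    refine Finset.sum_congr rfl fun vs _ => ?_
    rw [Finset.mul_sum]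
    refine Finset.sum_congr rfl fun cs _ => ?_
    simp [Fin.consEquiv, List.ofFn_succ, parkWeight, parkRun, stepWeight]

theorem exists_parkStep_eq_erase {H : Finset (Fin n)} (hH : H.Nonempty) (v : Fin n) (c : Bool) :
    ∃ h ∈ H, parkStep H v c = H.erase h := by
  unfold parkStep golfStep
  split_ifs with h1 h2
  · exact ⟨v, h1, rfl⟩
  · exact ⟨_, (distR_spec hH v).2.2.1, rfl⟩
  · exact ⟨_, (distL_spec hH v).2.2.1, rfl⟩

theorem exists_insert_of_parkStep_eq {H X : Finset (Fin n)} (hX : X.Nonempty) {v : Fin n}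
    {c : Bool} (h : parkStep H v c = X) : ∃ h ∈ Xᶜ, insert h X = H := by
  have hH : H.Nonempty := by
    rw [Finset.nonempty_iff_ne_empty]
    rintro rfl
    refine hX.ne_empty ?_
    rw [← h]
    simp [parkStep, golfStep]
  obtain ⟨z, hz, he⟩ := exists_parkStep_eq_erase hH v c
  refine ⟨z, ?_, ?_⟩
  · rw [← h, he]; simp
  · rw [← h, he, Finset.insert_erase hz]

theorem insert_erase_eq_iff {X : Finset (Fin n)} {h z : Fin n} (hh : h ∉ X)
    (hz : z ∈ insert h X) : (insert h X).erase z = X ↔ z = h := by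
  constructor
  · intro he
    rcases Finset.mem_insert.mp hz with h1 | h1
    · exact h1
    · rw [← he] at h1
      simp at h1
  · rintro rfl
    exact Finset.erase_insert hh

/-- The probability of parking on the positive side, in terms of the distances `a` and `c` to the
free spots on the negative and the positive side. -/
noncomputable def exitProb (p : ℝ) (a c : ℕ) : ℝ :=
  if p = 1 / 2 then (a : ℝ) / ((a : ℝ) + (c : ℝ))
  else (1 - ((1 - p) / p) ^ a) / (1 - ((1 - p) / p) ^ (a + c))

theorem rightProb_eq_exitProb (p : ℝ) (H : Finset (Fin n)) (v : Fin n) :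
    rightProb p H v = exitProb p (distL H v) (distR H v) := rfl

theorem stepMatrix_insert_apply (p : ℝ) {X : Finset (Fin n)} {x : Fin n} {k : ℕ} (hx : x ∈ X)
    (h1 : 1 ≤ k) (h2 : k < distR X x) :
    stepMatrix n p (insert (shiftR x k) X) X =
      1 + ∑ d ∈ Ico 1 k, exitProb p d (k - d) +
        ∑ d ∈ Ico 1 (distR X x - k), (1 - exitProb p d (distR X x - k - d)) := by
  set h := shiftR x k with hh
  set H := insert h X with hH
  have hhX : h ∉ X := (distR_spec ⟨x, hx⟩ x).2.2.2 k h1 h2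
  have hhH : h ∈ H := Finset.mem_insert_self _ _
  have hxH : x ∈ H := Finset.mem_insert_of_mem hx
  have hHne : H.Nonempty := ⟨h, hhH⟩
  have hDx : distR H x = k := distR_insert_left hx h1 h2
  have hDh : distR H h = distR X x - k := distR_insert_right hx h2
  have hfree : ∑ v ∈ H, ∑ c : Bool,
      stepWeight p H v c * (if parkStep H v c = X then 1 else 0) = 1 := by
    have : ∀ v ∈ H, ∑ c : Bool, stepWeight p H v c * (if parkStep H v c = X then 1 else 0) =
        if v = h then (1 : ℝ) else 0 := by
      intro v hv
      have he := insert_erase_eq_iff hhX hv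
      rw [← hH] at he
      simp only [stepWeight, parkStep, if_pos hv, he, Fintype.sum_bool]
      split_ifs <;> norm_num
    rw [Finset.sum_congr rfl this, Finset.sum_ite_eq' H h, if_pos hhH]
  have hocc : ∑ v ∈ Hᶜ, ∑ c : Bool,
      stepWeight p H v c * (if parkStep H v c = X then 1 else 0) =
      ∑ d ∈ Ico 1 k, exitProb p d (k - d) +
        ∑ d ∈ Ico 1 (distR X x - k), (1 - exitProb p d (distR X x - k - d)) := by
    rw [sum_compl_eq_sum_blocks hHne]
    have : ∀ y ∈ H, ∑ d ∈ Ico 1 (distR H y), ∑ c : Bool,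
        stepWeight p H (shiftR y d) c * (if parkStep H (shiftR y d) c = X then 1 else 0) =
        (if y = x then ∑ d ∈ Ico 1 (distR H y), exitProb p d (distR H y - d) else 0) +
        (if y = h then ∑ d ∈ Ico 1 (distR H y), (1 - exitProb p d (distR H y - d)) else 0) := by
      intro y hy
      have hs : shiftR y (distR H y) = h ↔ y = x := by
        constructor
        · intro he
          exact eq_of_shiftR_distR_eq hy hxH (by rw [he, hDx])
        · rintro rfl
          rw [hDx]
      have hterm : ∀ d ∈ Ico 1 (distR H y), ∑ c : Bool,
          stepWeight p H (shiftR y d) c * (if parkStep H (shiftR y d) c = X then 1 else 0) =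
          (if y = x then exitProb p d (distR H y - d) else 0) +
          (if y = h then 1 - exitProb p d (distR H y - d) else 0) := by
        intro d hd
        rw [Finset.mem_Ico] at hd
        have hv : shiftR y d ∉ H := (distR_spec hHne y).2.2.2 d hd.1 hd.2
        have e1 := insert_erase_eq_iff hhX (distR_spec hHne y).2.2.1
        have e2 := insert_erase_eq_iff hhX hy
        rw [← hH] at e1 e2
        simp only [stepWeight, parkStep, golfStep, if_neg hv, Fintype.sum_bool, if_true,
          Bool.false_eq_true, if_false, shiftR_distR_shiftR hy hd.2,
          shiftL_distL_shiftR hy hd.1 hd.2, e1, e2, hs, mul_ite, mul_one, mul_zero]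
        rw [rightProb_eq_exitProb, distL_shiftR hy hd.1 hd.2, distR_shiftR hy hd.2]
      rw [Finset.sum_congr rfl hterm, Finset.sum_add_distrib]
      congr 1 <;> split_ifs <;> simp
    rw [Finset.sum_congr rfl this, Finset.sum_add_distrib, Finset.sum_ite_eq' H x,
      Finset.sum_ite_eq' H h, if_pos hxH, if_pos hhH, hDx, hDh]
  rw [stepMatrix, Matrix.of_apply, ← Finset.sum_add_sum_compl H, hfree, hocc, add_assoc]

/-- The number of ways, weighted by the probabilities of the choices, in which `m` cars leave
exactly the spots of `X` free. -/
theorem stepMatrix_pow_univ (p : ℝ) (m : ℕ) {X : Finset (Fin n)} (hX : X.Nonempty)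
    (hcard : X.card + m = n) :
    (stepMatrix n p ^ m) univ X = m.factorial * ∏ x ∈ X, parkingNumber (distR X x - 1) := by
  induction m generalizing X with
  | zero =>
    have hXu : X = univ := by
      rw [← Finset.card_eq_iff_eq_univ, Fintype.card_fin]; exact hcard
    subst hXu
    have : ∀ x : Fin n, distR univ x = 1 := fun x =>
      distR_eq le_rfl (Finset.mem_univ _) fun e _ _ => by omega
    simp [this, parkingNumber]
  | succ m ih =>
    rw [pow_succ, Matrix.mul_apply]
    have hinj : Set.InjOn (fun h => insert h X) (Xᶜ : Finset (Fin n)) := by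
      intro a ha b hb hab
      have ha' : a ∉ X := by simpa using ha
      have : a ∈ insert b X := by
        rw [← show insert a X = insert b X from hab]; exact Finset.mem_insert_self _ _
      exact (Finset.mem_insert.mp this).resolve_right ha'
    have hsupp : ∑ H, (stepMatrix n p ^ m) univ H * stepMatrix n p H X =
        ∑ h ∈ Xᶜ, (stepMatrix n p ^ m) univ (insert h X) * stepMatrix n p (insert h X) X := by
      rw [← Finset.sum_image (f := fun H => (stepMatrix n p ^ m) univ H * stepMatrix n p H X)
        hinj]
      symm
      refine Finset.sum_subset (Finset.subset_univ _) fun H _ hH => ?_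
      have : stepMatrix n p H X = 0 := by
        rw [stepMatrix, Matrix.of_apply]
        refine Finset.sum_eq_zero fun v _ => Finset.sum_eq_zero fun c _ => ?_
        rw [if_neg, mul_zero]
        intro hs
        obtain ⟨h, h1, h2⟩ := exists_insert_of_parkStep_eq hX hs
        exact hH (Finset.mem_image.mpr ⟨h, h1, h2⟩)
      rw [this, mul_zero]
    rw [hsupp, sum_compl_eq_sum_blocks hX]
    have hblock : ∀ x ∈ X, ∑ k ∈ Ico 1 (distR X x),
        (stepMatrix n p ^ m) univ (insert (shiftR x k) X) *
          stepMatrix n p (insert (shiftR x k) X) X =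
        ((distR X x - 1 : ℕ) : ℝ) *
          (m.factorial * ∏ x ∈ X, parkingNumber (distR X x - 1)) := by
      intro x hx
      rw [← Finset.mul_prod_erase X _ hx]
      have hterm : ∀ k ∈ Ico 1 (distR X x),
          (stepMatrix n p ^ m) univ (insert (shiftR x k) X) *
            stepMatrix n p (insert (shiftR x k) X) X =
          (m.factorial * ∏ y ∈ X.erase x, parkingNumber (distR X y - 1)) *
            (parkingNumber (k - 1) * parkingNumber (distR X x - k - 1) *
              (1 + ∑ d ∈ Ico 1 k, exitProb p d (k - d) +
                ∑ d ∈ Ico 1 (distR X x - k), (1 - exitProb p d (distR X x - k - d)))) := by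
        intro k hk
        rw [Finset.mem_Ico] at hk
        have hhX : shiftR x k ∉ X := (distR_spec hX x).2.2.2 k hk.1 hk.2
        have hrest : ∏ y ∈ X.erase x, parkingNumber (distR (insert (shiftR x k) X) y - 1) =
            ∏ y ∈ X.erase x, parkingNumber (distR X y - 1) :=
          Finset.prod_congr rfl fun y hy => by
            rw [distR_insert_of_ne hx (Finset.mem_of_mem_erase hy) (Finset.ne_of_mem_erase hy)
              hk.1 hk.2]
        rw [ih (Finset.insert_nonempty _ _) (by rw [Finset.card_insert_of_notMem hhX]; omega),
          stepMatrix_insert_apply p hx hk.1 hk.2, Finset.prod_insert hhX,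
          ← Finset.mul_prod_erase X _ hx, hrest, distR_insert_left hx hk.1 hk.2,
          distR_insert_right hx hk.2]
        ring
      rw [Finset.sum_congr rfl hterm, ← Finset.mul_sum, sum_Ico_parkingNumber]
      ring
    rw [Finset.sum_congr rfl hblock, ← Finset.sum_mul, ← Nat.cast_sum, sum_distR_sub_one hX,
      show n - X.card = m + 1 by omega, Nat.factorial_succ]
    push_cast
    ring

end Chain

end Golf

namespace Golf

/-! ### Block sizes as gaps -/

section Blocks

variable {n : ℕ}

theorem one_le_cpos (v : Fin n) : 1 ≤ cpos v := by
  have := v.isLt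
  unfold cpos
  split_ifs <;> omega

theorem cpos_le (v : Fin n) : cpos v ≤ n := by
  have := v.isLt
  unfold cpos
  split_ifs <;> omega

theorem cpos_mod (v : Fin n) : cpos v % n = v.val := by
  unfold cpos
  split_ifs with h
  · rw [Nat.mod_self, h]
  · exact Nat.mod_eq_of_lt v.isLt

theorem cpos_injective : Function.Injective (cpos : Fin n → ℕ) := fun v w h =>
  Fin.ext (by rw [← cpos_mod v, ← cpos_mod w, h])

theorem cpos_eq_of_mod_eq {v : Fin n} {c : ℕ} (h1 : 1 ≤ c) (h2 : c ≤ n) (h : c % n = v.val) :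
    cpos v = c := by
  unfold cpos
  rcases h2.eq_or_lt with rfl | h2
  · rw [Nat.mod_self] at h
    rw [if_pos h.symm]
  · rw [Nat.mod_eq_of_lt h2] at h
    rw [if_neg (by omega), h]

theorem cpos_shiftR_of_le {v : Fin n} {d : ℕ} (h : cpos v + d ≤ n) :
    cpos (shiftR v d) = cpos v + d := by
  refine cpos_eq_of_mod_eq (le_add_right (one_le_cpos v)) h ?_
  rw [← Nat.mod_add_mod, cpos_mod]
  rfl

theorem cpos_shiftR_of_lt {v : Fin n} {d : ℕ} (hd : d ≤ n) (h : n < cpos v + d) :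
    cpos (shiftR v d) = cpos v + d - n := by
  have := cpos_le v
  refine cpos_eq_of_mod_eq (by omega) (by omega) ?_
  rw [← Nat.mod_eq_sub_mod h.le, ← Nat.mod_add_mod, cpos_mod]
  rfl

/-- The block sizes of `X` are its gaps, up to reindexing. -/
theorem exists_equiv_blockSize {X : Finset (Fin n)} {K : ℕ} (hX : X.card = K) (hK : 0 < K) :
    ∃ σ : Fin K ≃ X, ∀ i : Fin K, blockSize X i = distR X (σ i) - 1 := by
  have hcard : (X.image cpos).card = K := by
    rw [Finset.card_image_of_injective _ cpos_injective, hX]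
  set e := (X.image cpos).orderEmbOfFin hcard with he
  have hvert : ∀ j, ∃ v ∈ X, cpos v = e j := fun j =>
    Finset.mem_image.mp (Finset.orderEmbOfFin_mem _ hcard j)
  choose vert hvX hvc using hvert
  have hsurj : ∀ v ∈ X, ∃ j, e j = cpos v := by
    intro v hv
    have : cpos v ∈ Set.range e := by
      rw [he, Finset.range_orderEmbOfFin]
      exact Finset.mem_coe.mpr (Finset.mem_image_of_mem _ hv)
    exact this
  have hlen : (sortedPos X).length = K := by simp [sortedPos, hcard]
  have hget : ∀ j : Fin K, (sortedPos X).getD j.val 0 = e j := by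
    intro j
    rw [List.getD_eq_getElem _ _ (by rw [hlen]; exact j.isLt), he, Finset.orderEmbOfFin_apply]
    rfl
  let pred : Fin K → Fin K := fun i => ⟨(i.val + K - 1) % K, Nat.mod_lt _ hK⟩
  have hpred0 : ∀ i : Fin K, i.val = 0 → (pred i).val = K - 1 := fun i hi => by
    change (i.val + K - 1) % K = K - 1
    rw [hi, zero_add, Nat.mod_eq_of_lt (by omega)]
  have hpred : ∀ i : Fin K, i.val ≠ 0 → (pred i).val = i.val - 1 := fun i hi => by
    have := i.isLt
    change (i.val + K - 1) % K = i.val - 1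
    rw [show i.val + K - 1 = i.val - 1 + K by omega, Nat.add_mod_right,
      Nat.mod_eq_of_lt (by omega)]
  have hinj : Function.Injective fun i => (⟨vert (pred i), hvX _⟩ : X) := by
    intro i j hij
    have h1 : vert (pred i) = vert (pred j) := congrArg Subtype.val hij
    have h2 : pred i = pred j := e.injective (by rw [← hvc, ← hvc, h1])
    have h3 := congrArg Fin.val h2
    have hi := i.isLt
    have hj := j.isLt
    ext
    by_cases hi0 : i.val = 0 <;> by_cases hj0 : j.val = 0
    · omega
    · rw [hpred0 i hi0, hpred j hj0] at h3; omega
    · rw [hpred i hi0, hpred0 j hj0] at h3; omega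
    · rw [hpred i hi0, hpred j hj0] at h3; omega
  have hbij := (Fintype.bijective_iff_injective_and_card
    fun i => (⟨vert (pred i), hvX _⟩ : X)).mpr ⟨hinj, by simp [hX]⟩
  refine ⟨Equiv.ofBijective _ hbij, fun i => ?_⟩
  change blockSize X i = distR X (vert (pred i)) - 1
  have hb : blockSize X i = (e i + n - e (pred i) - 1) % n := by
    simp only [blockSize, hlen, ← hget]
    rw [Nat.mod_eq_of_lt i.isLt]
  have ha1 := one_le_cpos (vert (pred i))
  have ha2 := cpos_le (vert (pred i))
  have hb1 := one_le_cpos (vert i)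
  have hb2 := cpos_le (vert i)
  rw [hvc] at ha1 ha2 hb1 hb2
  by_cases hi : i.val = 0
  · have hba : e i ≤ e (pred i) := e.monotone (Fin.le_def.mpr (by omega))
    have hD : distR X (vert (pred i)) = e i + n - e (pred i) := by
      refine distR_eq (by omega) ?_ fun d hd1 hd2 hmem => ?_
      · have : cpos (shiftR (vert (pred i)) (e i + n - e (pred i))) = cpos (vert i) := by
          rw [cpos_shiftR_of_lt (by omega) (by rw [hvc]; omega), hvc, hvc]
          omega
        rw [cpos_injective this]
        exact hvX i
      · obtain ⟨j, hj⟩ := hsurj _ hmem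
        rcases le_or_gt (cpos (vert (pred i)) + d) n with h | h
        · rw [cpos_shiftR_of_le h, hvc] at hj
          have h1 : pred i < j := e.lt_iff_lt.mp (by omega)
          have h2 := hpred0 i hi
          have h3 := Fin.lt_def.mp h1
          omega
        · rw [cpos_shiftR_of_lt (by omega) h, hvc] at hj
          have h1 : j < i := e.lt_iff_lt.mp (by omega)
          have h3 := Fin.lt_def.mp h1
          omega
    rw [hb, hD, Nat.mod_eq_of_lt (by omega)]
  · have hp := hpred i hi
    have hba : e (pred i) < e i := e.strictMono (Fin.lt_def.mpr (by omega))
    have hD : distR X (vert (pred i)) = e i - e (pred i) := by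
      refine distR_eq (by omega) ?_ fun d hd1 hd2 hmem => ?_
      · have : cpos (shiftR (vert (pred i)) (e i - e (pred i))) = cpos (vert i) := by
          rw [cpos_shiftR_of_le (by rw [hvc]; omega), hvc, hvc]
          omega
        rw [cpos_injective this]
        exact hvX i
      · obtain ⟨j, hj⟩ := hsurj _ hmem
        rw [cpos_shiftR_of_le (by rw [hvc]; omega), hvc] at hj
        have h1 : pred i < j := e.lt_iff_lt.mp (by omega)
        have h2 : j < i := e.lt_iff_lt.mp (by omega)
        have h3 := Fin.lt_def.mp h1
        have h4 := Fin.lt_def.mp h2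
        omega
    rw [hb, hD, show e i + n - e (pred i) - 1 = e i - e (pred i) - 1 + n by omega,
      Nat.add_mod_right, Nat.mod_eq_of_lt (by omega)]

/-- The law of the remaining free spots, with a right-hand side free of `p`. -/
theorem parkProb_eq {m : ℕ} (hm : m < n) (p : ℝ) {X : Finset (Fin n)} (hX : X.card = n - m) :
    parkProb n m p X =
      (1 / (n : ℝ) ^ m) *
        (Nat.multinomial Finset.univ (fun i : Fin (n - m) => blockSize X i.val) : ℝ) *
        ∏ i : Fin (n - m), ((blockSize X i.val : ℝ) + 1) ^ (blockSize X i.val - 1) := by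
  have hne : X.Nonempty := Finset.card_pos.mp (by omega)
  obtain ⟨σ, hσ⟩ := exists_equiv_blockSize hX (by omega)
  have hsum : ∑ i : Fin (n - m), blockSize X i = m := by
    simp only [hσ]
    rw [σ.sum_comp (fun x => distR X x - 1), Finset.sum_coe_sort X (fun x => distR X x - 1),
      sum_distR_sub_one hne]
    omega
  have hprod : ∏ x ∈ X, parkingNumber (distR X x - 1) =
      ∏ i : Fin (n - m), parkingNumber (blockSize X i) := by
    simp only [hσ]
    rw [σ.prod_comp (fun x => parkingNumber (distR X x - 1)),
      Finset.prod_coe_sort X (fun x => parkingNumber (distR X x - 1))]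
  have hmul := Nat.multinomial_spec (Finset.univ : Finset (Fin (n - m)))
    (fun i => blockSize X i.val)
  rw [hsum] at hmul
  have hfac : (∏ i : Fin (n - m), ((blockSize X i).factorial : ℝ)) ≠ 0 :=
    Finset.prod_ne_zero_iff.mpr fun i _ => by positivity
  unfold parkProb parkExp
  rw [sum_parkWeight_eq_pow, stepMatrix_pow_univ p m hne (by omega), hprod, ← hmul]
  simp only [parkingNumber, Finset.prod_div_distrib]
  push_cast
  field_simp

end Blocks

end Golf

open Golf

/-- **Distribution of the set of remaining free spots in the `p`-parking model on `Z/nZ`**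
(Theorem 1.7 of the paper).  With `K = n - m ≥ 1`, for every `X` of cardinality `K`, writing
`ℓ_i = Δ_i X`,
`P(TL = X) = n^{-m} · multinom(m; ℓ_0, …, ℓ_{K-1}) · Π_i (ℓ_i + 1)^{ℓ_i - 1}`;
in particular this probability does not depend on `p ∈ (0,1)`. -/
theorem parking_remaining_spots_law (n m : ℕ) (hn : 1 ≤ n) (hm : m < n)
    (p : ℝ) (hp0 : 0 < p) (hp1 : p < 1)
    (X : Finset (Fin n)) (hX : X.card = n - m) :
    parkProb n m p X =
      (1 / (n : ℝ) ^ m) *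
        (Nat.multinomial Finset.univ (fun i : Fin (n - m) => blockSize X i.val) : ℝ) *
        ∏ i : Fin (n - m), ((blockSize X i.val : ℝ) + 1) ^ (blockSize X i.val - 1) ∧
    ∀ p' : ℝ, 0 < p' → p' < 1 → parkProb n m p' X = parkProb n m p X := by
  exact ⟨parkProb_eq hm p hX, fun p' _ _ => by rw [parkProb_eq hm p' hX, parkProb_eq hm p hX]⟩
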